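/- Let g be a Z₂×Z₂-flow of a graph G with circuit C such that each class E_{g=a}(C) (a ∈ Z₂×Z₂) has the same total weight ω(C)/4 with respect to a weight ω : E(G) → Z⁺. Let Q be a path of C between two vertices x and y that are odd-degree vertices in the same component of the subgraph of G − E(C) induced by edges with value in {a, a+b} (b nonzero). Then for each c ∈ Z₂×Z₂, ω(E_{g=c}(Q)) = ω(E_{g=c+b}(Q)). -/

import Mathlib

open Finset

/-- The number of endpoints of the (possibly looped) edge `s` equal to `v`
(a loop at `v` counts twice). -/
def edgeCount {V : Type} [DecidableEq V] (s : Sym2 V) (v : V) : ℕ :=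
  Sym2.lift ⟨fun a b => (if a = v then 1 else 0) + (if b = v then 1 else 0),
    fun a b => by dsimp; omega⟩ s

/-- A `ℤ₂ × ℤ₂`-flow of a multigraph with edge-ends map `ends`:
the values on edges incident with a vertex (loops counted twice) sum to `(0,0)`. -/
def IsFlow {V E : Type} [DecidableEq V] [Fintype E] (ends : E → Sym2 V)
    (f : E → ZMod 2 × ZMod 2) : Prop :=
  ∀ v : V, ∑ e : E, edgeCount (ends e) v • f e = 0

/-- An even subgraph (cycle): every vertex has even degree. -/
def IsEvenSub {V E : Type} [DecidableEq V] (ends : E → Sym2 V) (S : Finset E) : Prop :=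
  ∀ v : V, Even (∑ e ∈ S, edgeCount (ends e) v)

/-- A circuit: a nonempty connected 2-regular subgraph, given by its edge set. -/
def IsCircuit {V E : Type} [DecidableEq V] (ends : E → Sym2 V) (CE : Finset E) : Prop :=
  CE.Nonempty ∧
  (∀ v : V, (∑ e ∈ CE, edgeCount (ends e) v = 0) ∨ (∑ e ∈ CE, edgeCount (ends e) v = 2)) ∧
  ∀ e₁ ∈ CE, ∀ e₂ ∈ CE,
    Relation.ReflTransGen (fun a b => ∃ v : V, v ∈ ends a ∧ v ∈ ends b ∧ a ∈ CE ∧ b ∈ CE) e₁ e₂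



/-- The symplectic form on `ℤ₂ × ℤ₂`; `symp i` is the functional with kernel `{0, i}`. -/
def symp (i a : ZMod 2 × ZMod 2) : ZMod 2 := i.1 * a.2 + i.2 * a.1

lemma symp_add (i a b : ZMod 2 × ZMod 2) : symp i (a + b) = symp i a + symp i b := by
  simp [symp]; ring

lemma symp_zero (i : ZMod 2 × ZMod 2) : symp i 0 = 0 := by simp [symp]

lemma symp_sum {ι : Type} (s : Finset ι) (i : ZMod 2 × ZMod 2) (f : ι → ZMod 2 × ZMod 2) :
    symp i (∑ t ∈ s, f t) = ∑ t ∈ s, symp i (f t) := by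
  classical
  induction s using Finset.induction_on with
  | empty => simp [symp_zero]
  | insert a s ha ih => rw [Finset.sum_insert ha, Finset.sum_insert ha, symp_add, ih]

lemma exists_symp_one : ∀ i : ZMod 2 × ZMod 2, i ≠ 0 → ∃ j, symp j i = 1 ∧ symp i j = 1 := by
  decide

lemma symp_ext : ∀ i j a b : ZMod 2 × ZMod 2, symp j i = 1 → symp i a = symp i b →
    symp j a = symp j b → a = b := by decide

lemma z2_cases : ∀ a : ZMod 2, a = 0 ∨ a = 1 := by decide

/-- Partial sums. -/
def psum (d : ℕ → ZMod 2 × ZMod 2) (t : ℕ) : ZMod 2 × ZMod 2 := ∑ s ∈ range t, d s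

/-- Switch by `i` at the two positions `x`, `y`. -/
def sw (d : ℕ → ZMod 2 × ZMod 2) (i : ZMod 2 × ZMod 2) (x y : ℕ) : ℕ → ZMod 2 × ZMod 2 :=
  fun t => d t + if t = x ∨ t = y then i else 0

/-- Closure of a family of states under (some) Kempe switches, in cut form. -/
def KClosed (n : ℕ) (S : Set (ℕ → ZMod 2 × ZMod 2)) : Prop :=
  ∀ d ∈ S, ∀ i : ZMod 2 × ZMod 2, i ≠ 0 → ∀ B : Finset ℕ, B ⊆ range n →
    ∑ t ∈ B, symp i (d t) ≠ 0 →
    ∃ x y, x ∈ B ∧ y ∉ B ∧ y < n ∧ symp i (d x) = 1 ∧ symp i (d y) = 1 ∧ sw d i x y ∈ S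

lemma psum_succ (d : ℕ → ZMod 2 × ZMod 2) (t : ℕ) : psum d (t+1) = psum d t + d t := by
  simp [psum, Finset.sum_range_succ]

lemma sw_comm (d i x y) : sw d i x y = sw d i y x := by
  funext t; simp [sw, or_comm]

lemma zz_self (a : ZMod 2 × ZMod 2) : a + a = 0 := by revert a; decide

lemma psum_sw (d : ℕ → ZMod 2 × ZMod 2) (i) (x y : ℕ) (h : x < y) (t : ℕ) :
    psum (sw d i x y) t = psum d t + if t ∈ Ioc x y then i else 0 := by
  induction t with
  | zero => simp [psum]
  | succ t ih =>
    rw [psum_succ, psum_succ, ih]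
    simp only [sw, mem_Ioc]
    have := zz_self i
    rcases lt_trichotomy t x with h1 | h1 | h1
    · rw [if_neg (by omega), if_neg (by omega), if_neg (by omega)]; abel
    · rw [if_neg (by omega), if_pos (by omega), if_pos (by omega)]; abel
    · rcases lt_trichotomy t y with h2 | h2 | h2
      · rw [if_pos (by omega), if_neg (by omega), if_pos (by omega)]; abel
      · rw [if_pos (by omega), if_pos (by omega), if_neg (by omega)]
        rw [show psum d t + i + (d t + i) = psum d t + d t + (i + i) by abel, this]
      · rw [if_neg (by omega), if_neg (by omega), if_neg (by omega)]; abel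

lemma kclosed_sum_zero {n S} (hS : KClosed n S) {d} (hd : d ∈ S) : psum d n = 0 := by
  have key : ∀ i, i ≠ 0 → symp i (psum d n) = 0 := by
    intro i hi
    by_contra hne
    rw [psum, symp_sum] at hne
    obtain ⟨x, y, hx, hy, hyn, _⟩ := hS d hd i hi (range n) (le_refl _) hne
    exact hy (mem_range.2 hyn)
  generalize psum d n = z at key
  revert z; decide

/-- Parity function of mod 2 weights. -/
def par (w : ℕ → ZMod 2) (t : ℕ) : ZMod 2 := ∑ s ∈ range t, w s

lemma par_succ (w t) : par w (t+1) = par w t + w t := by simp [par, Finset.sum_range_succ]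

/-- Part of a state on positions of odd parity. -/
def opart (w : ℕ → ZMod 2) (d : ℕ → ZMod 2 × ZMod 2) : ℕ → ZMod 2 × ZMod 2 :=
  fun t => if par w (t+1) = 1 then d t else 0

def epart (w : ℕ → ZMod 2) (d : ℕ → ZMod 2 × ZMod 2) : ℕ → ZMod 2 × ZMod 2 :=
  fun t => if par w (t+1) = 1 then 0 else d t

lemma psum_split (w d t) : psum d t = psum (opart w d) t + psum (epart w d) t := by
  simp only [psum, ← Finset.sum_add_distrib]
  refine Finset.sum_congr rfl fun s _ => ?_
  simp only [opart, epart]; split_ifs <;> simp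

/-- abel summation on an interval, mod 2 -/
lemma abel2 (w : ℕ → ZMod 2) (d : ℕ → ZMod 2 × ZMod 2) (i) (x k : ℕ) :
    ∑ t ∈ Ioc x (x+k), w t * symp i (psum d t) =
      par w (x+k+1) * symp i (psum d (x+k+1)) - par w (x+1) * symp i (psum d (x+1))
      - (symp i (psum (opart w d) (x+k+1)) - symp i (psum (opart w d) (x+1))) := by
  induction k with
  | zero => simp
  | succ k ih =>
    rw [show x + (k+1) = (x+k)+1 by ring, ← Finset.insert_Ioc_right_eq_Ioc_add_one (by omega),
      Finset.sum_insert (by simp), ih]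
    rw [psum_succ d (x+k+1), psum_succ (opart w d) (x+k+1), par_succ w (x+k+1), symp_add, symp_add]
    have h1 : symp i (opart w d (x+k+1)) = (par w (x+k+1) + w (x+k+1)) * symp i (d (x+k+1)) := by
      simp only [opart, par_succ w (x+k+1)]
      rcases z2_cases (par w (x+k+1) + w (x+k+1)) with h | h <;> simp [h, symp_zero]
    rw [h1]; ring

section system
variable {n : ℕ} {S : Set (ℕ → ZMod 2 × ZMod 2)} {w : ℕ → ZMod 2} {m : ZMod 2}

lemma sw_arc (hw : ∀ d ∈ S, ∀ f : ZMod 2 × ZMod 2 → ZMod 2,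
      ∑ t ∈ range n, w t * f (psum d t) = m * ∑ c, f c)
    {d i x y} (hd : d ∈ S) (hd' : sw d i x y ∈ S) (hxy : x < y) (hy : y < n)
    (f : ZMod 2 × ZMod 2 → ZMod 2) :
    ∑ t ∈ Ioc x y, w t * (f (psum d t + i) - f (psum d t)) = 0 := by
  have h := (hw _ hd' f).trans (hw _ hd f).symm
  rw [← sub_eq_zero, ← Finset.sum_sub_distrib] at h
  rw [← h]
  have hsub : Ioc x y ⊆ range n := by intro t ht; simp at ht ⊢; omega
  rw [← Finset.sum_subset hsub]
  · refine Finset.sum_congr rfl fun t ht => ?_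
    rw [psum_sw d i x y hxy, if_pos ht]; ring
  · intro t _ ht
    rw [psum_sw d i x y hxy, if_neg ht]; simp

lemma sw_parity_lt (hw : ∀ d ∈ S, ∀ f : ZMod 2 × ZMod 2 → ZMod 2,
      ∑ t ∈ range n, w t * f (psum d t) = m * ∑ c, f c)
    {d i x y} (hi : i ≠ 0) (hd : d ∈ S) (hd' : sw d i x y ∈ S) (hxy : x < y) (hy : y < n) :
    par w (x+1) = par w (y+1) ∧ (par w (x+1) = 0 →
      symp i (psum (opart w d) x) = symp i (psum (opart w d) y)) := by
  obtain ⟨j, hj, hj'⟩ := exists_symp_one i hi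
  have h1 := sw_arc hw hd hd' hxy hy (symp j)
  have h2 := sw_arc hw hd hd' hxy hy (fun c => if c = j then 1 else 0)
  have e1 : par w (x+1) = par w (y+1) := by
    have : par w (y+1) = par w (x+1) + ∑ t ∈ Ioc x y, w t := by
      rw [par, par, Finset.range_eq_Ico, Finset.range_eq_Ico,
        ← Finset.sum_Ico_consecutive w (Nat.zero_le (x+1)) (by omega : x+1 ≤ y+1)]
      congr 1
      exact Finset.sum_congr (by ext t; simp only [mem_Ico, mem_Ioc]; omega) fun _ _ => rfl
    rw [this]
    rw [Finset.sum_congr rfl (g := w) (fun t _ => by rw [symp_add, hj]; ring)] at h1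
    rw [h1, add_zero]
  refine ⟨e1, fun h0 => ?_⟩
  have h3 : ∑ t ∈ Ioc x y, w t * symp i (psum d t) = 0 := by
    rw [← h2]
    refine Finset.sum_congr rfl fun t _ => ?_
    congr 1
    have : ∀ i j c : ZMod 2 × ZMod 2, i ≠ 0 → symp i j = 1 →
      symp i c = (if c + i = j then 1 else 0) - (if c = j then 1 else 0) := by decide
    exact this i j _ hi hj'
  obtain ⟨k, rfl⟩ := Nat.exists_eq_add_of_lt hxy
  have h4 := abel2 w d i x (k+1)
  rw [show x + (k+1) = x+k+1 by ring, h3, ← e1, h0] at h4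
  rw [psum_succ (opart w d) x, psum_succ (opart w d) (x+k+1)] at h4
  have o1 : opart w d x = 0 := by simp [opart, h0]
  have o2 : opart w d (x+k+1) = 0 := by simp [opart, ← e1, h0]
  rw [o1, o2] at h4
  simp only [add_zero, zero_mul, sub_zero, zero_sub] at h4
  have h5 := neg_eq_zero.1 h4.symm
  exact (sub_eq_zero.1 h5).symm

lemma sw_parity (hw : ∀ d ∈ S, ∀ f : ZMod 2 × ZMod 2 → ZMod 2,
      ∑ t ∈ range n, w t * f (psum d t) = m * ∑ c, f c)
    {d i x y} (hi : i ≠ 0) (hd : d ∈ S) (hd' : sw d i x y ∈ S) (hxy : x ≠ y) (hx : x < n)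
    (hy : y < n) :
    par w (x+1) = par w (y+1) ∧ (par w (x+1) = 0 →
      symp i (psum (opart w d) x) = symp i (psum (opart w d) y)) := by
  rcases lt_or_gt_of_ne hxy with h | h
  · exact sw_parity_lt hw hi hd hd' h hy
  · rw [sw_comm] at hd'
    have := sw_parity_lt hw hi hd hd' h hx
    exact ⟨this.1.symm, fun h0 => (this.2 (this.1.trans h0)).symm⟩

/-- Step 3. -/
lemma step3 (hS : KClosed n S) (hw : ∀ d ∈ S, ∀ f : ZMod 2 × ZMod 2 → ZMod 2,
      ∑ t ∈ range n, w t * f (psum d t) = m * ∑ c, f c)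
    {d i} (hi : i ≠ 0) (hd : d ∈ S) (s : ZMod 2) :
    ∑ t ∈ (range n).filter (fun t => par w (t+1) = 0 ∧ symp i (psum (opart w d) t) = s),
      symp i (d t) = 0 := by
  by_contra hne
  obtain ⟨x, y, hx, hy, hyn, _, _, hd'⟩ := hS d hd i hi _ (Finset.filter_subset _ _) hne
  simp only [mem_filter, mem_range] at hx hy
  have hxy : x ≠ y := by rintro rfl; exact hy hx
  have := sw_parity hw hi hd hd' hxy hx.1 hyn
  exact hy ⟨hyn, this.1 ▸ hx.2.1, (this.2 hx.2.1) ▸ hx.2.2⟩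

/-- Step 4. -/
lemma step4 (hS : KClosed n S) (hw : ∀ d ∈ S, ∀ f : ZMod 2 × ZMod 2 → ZMod 2,
      ∑ t ∈ range n, w t * f (psum d t) = m * ∑ c, f c)
    {d i x y} (hi : i ≠ 0) (hd : d ∈ S) (hd' : sw d i x y ∈ S) (hxy : x ≠ y) (hx : x < n)
    (hy : y < n) (h0 : par w (x+1) = 0) :
    psum (opart w d) x = psum (opart w d) y := by
  obtain ⟨e1, e2⟩ := sw_parity hw hi hd hd' hxy hx hy
  obtain ⟨j, hj, hj'⟩ := exists_symp_one i hi
  have hj0 : j ≠ 0 := by rintro rfl; simp [symp] at hj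
  refine symp_ext i j _ _ hj (e2 h0) ?_
  by_contra hne
  have ho : opart w (sw d i x y) = opart w d := by
    funext t
    simp only [opart, sw]
    split_ifs with h1 h2
    · exfalso
      rcases h2 with rfl | rfl
      · rw [h0] at h1; exact absurd h1 (by decide)
      · rw [← e1, h0] at h1; exact absurd h1 (by decide)
    · simp
    · rfl
  have a1 := step3 hS hw hj0 hd (symp j (psum (opart w d) x))
  have a2 := step3 hS hw hj0 hd' (symp j (psum (opart w d) x))
  rw [ho] at a2
  rw [← Finset.add_sum_erase _ _ (show x ∈ _ by simp [hx, h0])] at a1 a2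
  have : ∀ t ∈ ((range n).filter (fun t => par w (t+1) = 0 ∧ symp j (psum (opart w d) t) =
      symp j (psum (opart w d) x))).erase x, symp j (sw d i x y t) = symp j (d t) := by
    intro t ht
    simp only [mem_erase, mem_filter] at ht
    simp only [sw]
    rw [if_neg, add_zero]
    rintro (h | h)
    · exact ht.1 h
    · subst h; exact hne ht.2.2.2.symm
  rw [Finset.sum_congr rfl this] at a2
  have b : symp j (sw d i x y x) = symp j (d x) + 1 := by simp [sw, symp_add, hj]
  rw [b] at a2
  have c := sub_eq_zero.2 (a2.trans a1.symm)
  ring_nf at c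
  exact absurd c (by decide)

/-- Step 5. -/
lemma step5 (hS : KClosed n S) (hw : ∀ d ∈ S, ∀ f : ZMod 2 × ZMod 2 → ZMod 2,
      ∑ t ∈ range n, w t * f (psum d t) = m * ∑ c, f c)
    {d} (hd : d ∈ S) (i a : ZMod 2 × ZMod 2) :
    ∑ t ∈ (range n).filter (fun t => par w (t+1) = 0 ∧ psum (opart w d) t = a),
      symp i (d t) = 0 := by
  by_cases hi : i = 0
  · subst hi; simp [symp]
  by_contra hne
  obtain ⟨x, y, hx, hy, hyn, _, _, hd'⟩ := hS d hd i hi _ (Finset.filter_subset _ _) hne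
  simp only [mem_filter, mem_range] at hx hy
  have hxy : x ≠ y := by rintro rfl; exact hy hx
  have h1 := sw_parity hw hi hd hd' hxy hx.1 hyn
  have h2 := step4 hS hw hi hd hd' hxy hx.1 hyn hx.2.1
  exact hy ⟨hyn, h1.1 ▸ hx.2.1, h2 ▸ hx.2.2⟩

end system

/-- integer lift -/
def zl (a : ZMod 2) : ℤ := if a = 1 then 1 else 0

lemma expand (G : ZMod 2 × ZMod 2 → ℤ) (b : ZMod 2 × ZMod 2) :
    2 * G b = 2 * G 0 + ∑ l, ((∑ c, G c) - 4 * G 0 - 2 * (G l - G 0)) * zl (symp l b) := by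
  have hu : (Finset.univ : Finset (ZMod 2 × ZMod 2)) = {(0,0),(0,1),(1,0),(1,1)} := by decide
  have hb : b ∈ (Finset.univ : Finset (ZMod 2 × ZMod 2)) := Finset.mem_univ b
  have e : (0 : ZMod 2 × ZMod 2) = (0,0) := rfl
  have h2 : (1 + 1 : ZMod 2) = 0 := by decide
  rw [hu] at hb ⊢
  rw [e]
  simp only [Finset.mem_insert, Finset.mem_singleton] at hb
  rcases hb with rfl | rfl | rfl | rfl <;>
  simp [Finset.sum_insert, symp, zl, h2] <;> ring

lemma sum_abel (W : ℕ → ℤ) (P : ℕ → ℤ) (n : ℕ) :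
    ∑ t ∈ range n, (W (t+1) - W t) * P t =
      W n * P n - W 0 * P 0 - ∑ t ∈ range n, W (t+1) * (P (t+1) - P t) := by
  induction n with
  | zero => simp
  | succ n ih => rw [Finset.sum_range_succ, Finset.sum_range_succ, ih]; ring

theorem lemM (n : ℕ) (k : ℕ) : ∀ (S : Set (ℕ → ZMod 2 × ZMod 2)) (w : ℕ → ZMod 2) (m : ZMod 2)
    (A : Finset ℕ), A.card ≤ k → KClosed n S → (∀ d ∈ S, ∀ t, t ∉ A → d t = 0) →
    (∀ d ∈ S, ∀ f : ZMod 2 × ZMod 2 → ZMod 2,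
      ∑ t ∈ range n, w t * f (psum d t) = m * ∑ c, f c) →
    ∀ d ∈ S, ∀ F : ZMod 2 × ZMod 2 → ℤ,
      ∑ t ∈ range n, (zl (par w (t+1)) - zl (par w t)) * F (psum d t) = 0 := by
  induction k with
  | zero =>
    intro S w m A hA hS hsupp hw d hd F
    have hA0 : A = ∅ := Finset.card_eq_zero.1 (Nat.le_zero.1 hA)
    have hp : ∀ t, psum d t = 0 := fun t =>
      Finset.sum_eq_zero fun s _ => hsupp d hd s (by simp [hA0])
    have hn : par w n = 0 := by
      have := hw d hd (fun _ => 1)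
      simp only [mul_one, Finset.sum_const, Finset.card_univ] at this
      rw [par, this]
      have : Fintype.card (ZMod 2 × ZMod 2) = 4 := by decide
      rw [this]; rcases z2_cases m with h | h <;> subst h <;> decide
    simp only [hp]
    rw [← Finset.sum_mul, Finset.sum_range_sub (fun t => zl (par w t)), hn]
    simp [par]
  | succ k ih =>
    intro S w m A hA hS hsupp hw d hd F
    have hn : par w n = 0 := by
      have := hw d hd (fun _ => 1)
      simp only [mul_one, Finset.sum_const, Finset.card_univ] at this
      rw [par, this]
      have : Fintype.card (ZMod 2 × ZMod 2) = 4 := by decide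
      rw [this]; rcases z2_cases m with h | h <;> subst h <;> decide
    rw [sum_abel (fun t => zl (par w t)) (fun t => F (psum d t))]
    have hpn := kclosed_sum_zero hS hd
    -- rewrite as a sum over even positions
    have hE : ∑ t ∈ range n, (F (psum d (t+1)) - F (psum d t)) = 0 := by
      rw [Finset.sum_range_sub (fun t => F (psum d t)), hpn]; simp [psum]
    suffices h : ∑ t ∈ range n, (1 - zl (par w (t+1))) * (F (psum d (t+1)) - F (psum d t)) = 0 by
      have h' : ∑ t ∈ range n, zl (par w (t+1)) * (F (psum d (t+1)) - F (psum d t)) = 0 := by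
        have : ∑ t ∈ range n, (1 - zl (par w (t+1))) * (F (psum d (t+1)) - F (psum d t)) =
          ∑ t ∈ range n, (F (psum d (t+1)) - F (psum d t)) -
          ∑ t ∈ range n, zl (par w (t+1)) * (F (psum d (t+1)) - F (psum d t)) := by
          rw [← Finset.sum_sub_distrib]; exact Finset.sum_congr rfl fun _ _ => by ring
        rw [hE, h] at this; linarith
      rw [h', hn]; simp [zl, par]
    by_cases hAE : ∃ t ∈ A, par w (t+1) = 0
    swap
    · push Not at hAE
      refine Finset.sum_eq_zero fun t _ => ?_
      by_cases htA : t ∈ A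
      · have : par w (t+1) = 1 := (z2_cases _).resolve_left (hAE t htA)
        simp [this, zl]
      · rw [psum_succ, hsupp d hd t htA]; simp
    obtain ⟨t0, ht0, ht0'⟩ := hAE
    -- the induction hypothesis
    have IH : ∀ l : ZMod 2 × ZMod 2, ∀ F' : ZMod 2 × ZMod 2 → ℤ,
        ∑ t ∈ range n, (zl (symp l (psum (epart w d) (t+1))) - zl (symp l (psum (epart w d) t)))
          * F' (psum (opart w d) t) = 0 := by
      intro l F'
      have hpar : ∀ t, par (fun t => symp l (epart w d t)) t = symp l (psum (epart w d) t) := by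
        intro t; rw [psum, symp_sum, par]
      have := ih {d' | ∃ d₁ ∈ S, epart w d₁ = epart w d ∧ d' = opart w d₁}
        (fun t => symp l (epart w d t)) 0 (A.filter fun t => par w (t+1) = 1) ?_ ?_ ?_ ?_
        (opart w d) ⟨d, hd, rfl, rfl⟩ F'
      · simpa only [hpar] using this
      · have : (A.filter fun t => par w (t+1) = 1).card < A.card := by
          apply Finset.card_lt_card
          refine (Finset.ssubset_iff_of_subset (Finset.filter_subset _ _)).2 ⟨t0, ht0, ?_⟩
          simp [ht0']
        omega
      · rintro _ ⟨d₁, hd₁, he, rfl⟩ i hi B hB hne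
        have hne' : ∑ t ∈ B.filter (fun t => par w (t+1) = 1), symp i (d₁ t) ≠ 0 := by
          rw [Finset.sum_filter]
          convert hne using 2
          simp only [opart]; split_ifs <;> simp [symp_zero]
        obtain ⟨x, y, hx, hy, hyn, h1, h2, hd'⟩ :=
          hS d₁ hd₁ i hi _ ((Finset.filter_subset _ _).trans hB) hne'
        have hxy : x ≠ y := by rintro rfl; exact hy hx
        rw [mem_filter] at hx hy
        have hxn := mem_range.1 (hB hx.1)
        have hp := (sw_parity hw hi hd₁ hd' hxy hxn hyn).1
        have hyo : par w (y+1) = 1 := hp ▸ hx.2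
        refine ⟨x, y, hx.1, fun h => hy ⟨h, hyo⟩, hyn, ?_, ?_, sw d₁ i x y, hd', ?_, ?_⟩
        · simpa [opart, hx.2] using h1
        · simpa [opart, hyo] using h2
        · rw [← he]; funext t
          simp only [epart, sw]
          split_ifs with a b
          · rfl
          · rcases b with rfl | rfl
            · exact absurd hx.2 a
            · exact absurd hyo a
          · simp
        · funext t
          simp only [opart, sw]
          by_cases b : par w (t+1) = 1
          · rw [if_pos b, if_pos b]
          · rw [if_neg b, if_neg b, if_neg, add_zero]
            rintro (rfl | rfl)
            · exact b hx.2
            · exact b hyo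
      · rintro _ ⟨d₁, hd₁, he, rfl⟩ t ht
        simp only [opart]
        split_ifs with a
        · exact hsupp d₁ hd₁ t fun h => ht (mem_filter.2 ⟨h, a⟩)
        · rfl
      · rintro _ ⟨d₁, hd₁, he, rfl⟩ f
        rw [zero_mul, ← he]
        have h5 := step5 hS hw hd₁ l
        have : ∀ t, symp l (epart w d₁ t) * f (psum (opart w d₁) t) =
            ∑ a, f a * (if par w (t+1) = 0 ∧ psum (opart w d₁) t = a then symp l (d₁ t) else 0) := by
          intro t
          rw [Finset.sum_eq_single (psum (opart w d₁) t)]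
          · simp only [epart]
            rcases z2_cases (par w (t+1)) with h | h <;> simp [h, symp_zero, mul_comm]
          · intro b _ hb; rw [if_neg (fun h => hb h.2.symm), mul_zero]
          · simp
        simp only [this]
        rw [Finset.sum_comm]
        refine Finset.sum_eq_zero fun a _ => ?_
        rw [← Finset.mul_sum, ← Finset.sum_filter, h5 a, mul_zero]
    -- expansion
    have hterm : ∀ t, 2 * ((1 - zl (par w (t+1))) * (F (psum d (t+1)) - F (psum d t))) =
        ∑ l, (zl (symp l (psum (epart w d) (t+1))) - zl (symp l (psum (epart w d) t))) *
          ((∑ c, F (psum (opart w d) t + c)) - 4 * F (psum (opart w d) t + 0)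
            - 2 * (F (psum (opart w d) t + l) - F (psum (opart w d) t + 0))) := by
      intro t
      rcases z2_cases (par w (t+1)) with h | h
      · have ho : psum (opart w d) (t+1) = psum (opart w d) t := by
          rw [psum_succ]; simp [opart, h]
        have e1 := expand (fun c => F (psum (opart w d) t + c)) (psum (epart w d) (t+1))
        have e2 := expand (fun c => F (psum (opart w d) t + c)) (psum (epart w d) t)
        rw [psum_split w d (t+1), psum_split w d t, ho, h]
        have : zl 0 = 0 := by simp [zl]
        rw [this]
        simp only [sub_mul, Finset.sum_sub_distrib]
        simp only [mul_comm (zl _)]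
        linarith
      · have : psum (epart w d) (t+1) = psum (epart w d) t := by
          rw [psum_succ]; simp [epart, h]
        simp [this, h, zl]
    have : 2 * ∑ t ∈ range n, (1 - zl (par w (t+1))) * (F (psum d (t+1)) - F (psum d t)) = 0 := by
      rw [Finset.mul_sum]
      simp only [hterm]
      rw [Finset.sum_comm]
      exact Finset.sum_eq_zero fun l _ => IH l (fun a =>
        (∑ c, F (a + c)) - 4 * F (a + 0) - 2 * (F (a + l) - F (a + 0)))
    linarith

theorem descent (n : ℕ) (S : Set (ℕ → ZMod 2 × ZMod 2)) (hS : KClosed n S)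
    (A : Finset ℕ) (hsupp : ∀ d ∈ S, ∀ t, t ∉ A → d t = 0) (hne : S.Nonempty) :
    ∀ (M : ℕ) (w : ℕ → ℕ), (∀ d ∈ S, ∀ c,
      ∑ t ∈ range n, (if psum d t = c then w t else 0) = M) → M = 0 := by
  intro M
  induction M using Nat.strong_induction_on with
  | _ M ih =>
  intro w hw
  by_contra hM
  obtain ⟨d₀, hd₀⟩ := hne
  have hm := lemM n A.card S (fun t => (w t : ZMod 2)) (M : ZMod 2) A le_rfl hS hsupp (by
    intro d hd f
    have : ∀ t, (w t : ZMod 2) * f (psum d t) =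
        ∑ c, f c * ((if psum d t = c then w t else 0 : ℕ) : ZMod 2) := by
      intro t
      rw [Finset.sum_eq_single (psum d t)]
      · simp [mul_comm]
      · intro b _ hb; simp [hb.symm]
      · simp
    simp only [this]
    rw [Finset.sum_comm, Finset.mul_sum]
    refine Finset.sum_congr rfl fun c _ => ?_
    rw [← Finset.mul_sum, ← Nat.cast_sum, hw d hd c, mul_comm])
  set u := par (fun t => (w t : ZMod 2)) with hu
  have hex : ∀ t, ∃ k : ℕ, (2 * k : ℤ) = w t + (zl (u (t+1)) - zl (u t)) := by
    intro t
    have h1 : u (t+1) = u t + (w t : ZMod 2) := par_succ _ t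
    rcases Nat.even_or_odd' (w t) with ⟨q, hq | hq⟩
    · have : (w t : ZMod 2) = 0 := by
        rw [hq]; push_cast; rw [show (2 : ZMod 2) = 0 by decide]; simp
      rw [h1, this]; exact ⟨q, by simp [hq]⟩
    · have : (w t : ZMod 2) = 1 := by
        rw [hq]; push_cast; rw [show (2 : ZMod 2) = 0 by decide]; simp
      rw [h1, this]
      rcases z2_cases (u t) with h | h
      · rw [h]; exact ⟨q+1, by simp [hq, zl]; ring⟩
      · rw [h]; refine ⟨q, ?_⟩
        rw [show (1 + 1 : ZMod 2) = 0 by decide]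
        simp [hq, zl]
  choose w' hw' using hex
  have hsum : ∀ d ∈ S, ∀ c, 2 * ∑ t ∈ range n, (if psum d t = c then w' t else 0) = M := by
    intro d hd c
    have h1 := hw d hd c
    have h2 := hm d hd (fun a => if a = c then 1 else 0)
    zify at h1 ⊢
    have h3 := congrArg₂ (· + ·) h1 h2
    simp only [add_zero] at h3
    rw [← h3, Finset.mul_sum, ← Finset.sum_add_distrib]
    refine Finset.sum_congr rfl fun t _ => ?_
    split_ifs
    · rw [hw' t]; ring
    · simp
  have h0 := hsum d₀ hd₀ 0
  have := ih (M / 2) (by omega) w' (by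
    intro d hd c
    have := hsum d hd c
    omega)
  omega

section graph
variable {V E : Type} [Fintype V] [Fintype E] [DecidableEq V] [DecidableEq E]

lemma edgeCount_mk (a b v : V) : edgeCount s(a, b) v =
    (if a = v then 1 else 0) + (if b = v then 1 else 0) := rfl

lemma edgeCount_pos_of_mem {s : Sym2 V} {v : V} (h : v ∈ s) : 0 < edgeCount s v := by
  induction s using Sym2.ind with
  | _ a b =>
    rw [edgeCount_mk]
    rcases Sym2.mem_iff.1 h with rfl | rfl <;> simp

lemma edgeCount_eq_zero {s : Sym2 V} {v : V} (h : v ∉ s) : edgeCount s v = 0 := by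
  induction s using Sym2.ind with
  | _ a b =>
    rw [edgeCount_mk]
    rw [Sym2.mem_iff, not_or] at h
    rw [if_neg (Ne.symm h.1), if_neg (Ne.symm h.2)]

/-- A path between the two vertices of degree one. -/
lemma path_exists (ends : E → Sym2 V) (k : ℕ) : ∀ (R : Finset E) (x y : V), R.card ≤ k → x ≠ y →
    ∑ e ∈ R, edgeCount (ends e) x = 1 → ∑ e ∈ R, edgeCount (ends e) y = 1 →
    (∀ u, u ≠ x → u ≠ y → ∑ e ∈ R, edgeCount (ends e) u = 0 ∨ ∑ e ∈ R, edgeCount (ends e) u = 2) →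
    ∃ (n : ℕ) (e : ℕ → E) (v : ℕ → V), v 0 = x ∧ v n = y ∧
      (∀ t < n, e t ∈ R ∧ ends (e t) = s(v t, v (t+1))) ∧
      (∀ t ≤ n, 0 < ∑ f ∈ R, edgeCount (ends f) (v t)) ∧
      (∀ s t, s ≤ n → t ≤ n → v s = v t → s = t) := by
  induction k with
  | zero =>
    intro R x y hR hxy hx
    rw [Finset.card_eq_zero.1 (Nat.le_zero.1 hR)] at hx
    simp at hx
  | succ k ih =>
    intro R x y hR hxy hx hy hu
    have : ∃ e ∈ R, edgeCount (ends e) x ≠ 0 := by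
      by_contra h
      push Not at h
      rw [Finset.sum_eq_zero h] at hx; exact absurd hx (by simp)
    obtain ⟨e, heR, hex⟩ := this
    have hmem : x ∈ ends e := by by_contra h; exact hex (edgeCount_eq_zero h)
    obtain ⟨z, hz⟩ := Sym2.mem_iff_exists.1 hmem
    have hsum : ∀ u, edgeCount (ends e) u + ∑ f ∈ R.erase e, edgeCount (ends f) u =
        ∑ f ∈ R, edgeCount (ends f) u := fun u => Finset.add_sum_erase R (fun f => edgeCount (ends f) u) heR
    have hc : ∀ u, edgeCount (ends e) u = (if x = u then 1 else 0) + (if z = u then 1 else 0) := by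
      intro u; rw [hz, edgeCount_mk]
    have hzx : x ≠ z := by
      rintro rfl
      have := hsum x
      rw [hc, hx] at this; simp at this; omega
    have hx0 : ∑ f ∈ R.erase e, edgeCount (ends f) x = 0 := by
      have := hsum x
      rw [hc, hx, if_pos rfl, if_neg hzx.symm] at this; omega
    by_cases hzy : z = y
    · subst hzy
      refine ⟨1, fun _ => e, fun t => if t = 0 then x else z, by simp, by simp, ?_, ?_, ?_⟩
      · intro t ht; obtain rfl : t = 0 := by omega
        exact ⟨heR, by simpa using hz⟩
      · intro t _
        dsimp only
        split_ifs <;> omega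
      · intro s t hs ht h
        dsimp only at h
        split_ifs at h
        · omega
        · exact absurd h hzx
        · exact absurd h.symm hzx
        · omega
    · have hz1 : ∑ f ∈ R.erase e, edgeCount (ends f) z = 1 := by
        have := hsum z
        rw [hc, if_neg hzx, if_pos rfl] at this
        rcases hu z hzx.symm hzy with h | h <;> omega
      have hy1 : ∑ f ∈ R.erase e, edgeCount (ends f) y = 1 := by
        have := hsum y
        rw [hc, if_neg hxy, if_neg hzy] at this; omega
      obtain ⟨n, e', v', h0, hn, hE, hpos, hinj⟩ := ih (R.erase e) z y
        (by rw [Finset.card_erase_of_mem heR]; omega) hzy hz1 hy1 (by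
          intro u huz huy
          by_cases hux : u = x
          · subst hux; exact Or.inl hx0
          · have := hsum u
            rw [hc, if_neg (Ne.symm hux), if_neg (Ne.symm huz)] at this
            rcases hu u hux huy with h | h
            · left; omega
            · right; omega)
      refine ⟨n+1, fun t => if t = 0 then e else e' (t-1), fun t => if t = 0 then x else v' (t-1),
        by simp, by simpa using hn, ?_, ?_, ?_⟩
      · intro t ht
        rcases t with _ | t
        · simp [heR, hz, h0]
        · have := hE t (by omega)
          simp only [Nat.add_eq_zero_iff, one_ne_zero, and_false, if_false, Nat.add_sub_cancel]
          exact ⟨Finset.mem_of_mem_erase this.1, this.2⟩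
      · intro t ht
        rcases t with _ | t
        · simp [hx]
        · have h1 := hpos t (by omega)
          have h2 := hsum (v' t)
          simp only [Nat.add_eq_zero_iff, one_ne_zero, and_false, if_false, Nat.add_sub_cancel]
          omega
      · intro s t hs ht h
        have hne : ∀ t ≤ n, v' t ≠ x := by
          intro t ht h; have := hpos t ht; rw [h, hx0] at this; omega
        rcases s with _ | s <;> rcases t with _ | t
        · rfl
        · simp at h; exact absurd h.symm (hne t (by omega))
        · simp at h; exact absurd h (hne s (by omega))
        · simp at h; rw [hinj s t (by omega) (by omega) h]

/-- Cyclic enumeration of a circuit. -/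
lemma circuit_enum (ends : E → Sym2 V) (CE : Finset E) (hC : IsCircuit ends CE) :
    ∃ (n : ℕ) (e : ℕ → E) (v : ℕ → V), 0 < n ∧ v n = v 0 ∧
      (∀ t < n, ends (e t) = s(v t, v (t+1))) ∧
      (∀ s t, s < n → t < n → v s = v t → s = t) ∧
      (∀ s t, s < n → t < n → e s = e t → s = t) ∧
      CE = (range n).image e := by
  obtain ⟨⟨e₀, he₀⟩, hdeg, hconn⟩ := hC
  -- it suffices to have everything but surjectivity
  suffices h : ∃ (n : ℕ) (e : ℕ → E) (v : ℕ → V), 0 < n ∧ v n = v 0 ∧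
      (∀ t < n, ends (e t) = s(v t, v (t+1))) ∧
      (∀ s t, s < n → t < n → v s = v t → s = t) ∧
      (∀ s t, s < n → t < n → e s = e t → s = t) ∧ (∀ t < n, e t ∈ CE) by
    obtain ⟨n, e, v, hn, hv, hE, hvi, hei, hmem⟩ := h
    refine ⟨n, e, v, hn, hv, hE, hvi, hei, ?_⟩
    have hsub : (range n).image e ⊆ CE := by
      intro f hf
      obtain ⟨t, ht, rfl⟩ := mem_image.1 hf
      exact hmem t (mem_range.1 ht)
    refine Finset.Subset.antisymm ?_ hsub
    intro f hf
    have key : ∀ f, Relation.ReflTransGen (fun a b => ∃ v : V, v ∈ ends a ∧ v ∈ ends b ∧ a ∈ CE ∧ b ∈ CE)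
        (e 0) f → f ∈ (range n).image e := by
      intro f hf
      induction hf with
      | refl => exact mem_image.2 ⟨0, mem_range.2 hn, rfl⟩
      | @tail b c _ hbc ih =>
        obtain ⟨u, hub, huc, hb, hc⟩ := hbc
        obtain ⟨t, ht, rfl⟩ := mem_image.1 ih
        rw [mem_range] at ht
        have hus : ∃ s < n, u = v s := by
          rw [hE t ht] at hub
          rcases Sym2.mem_iff.1 hub with h | h
          · exact ⟨t, ht, h⟩
          · by_cases h1 : t + 1 < n
            · exact ⟨t+1, h1, h⟩
            · obtain rfl : n = t+1 := by omega
              exact ⟨0, hn, by rw [h, hv]⟩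
        obtain ⟨s, hs, rfl⟩ := hus
        by_contra hcn
        have h2 : 2 ≤ ∑ f ∈ (range n).image e, edgeCount (ends f) (v s) := by
          rw [Finset.sum_image (fun a ha b hb h => hei a b (mem_range.1 ha) (mem_range.1 hb) h)]
          have : ∀ t ∈ range n, edgeCount (ends (e t)) (v s) =
              (if v t = v s then 1 else 0) + (if v (t+1) = v s then 1 else 0) := by
            intro t ht; rw [hE t (mem_range.1 ht), edgeCount_mk]
          rw [Finset.sum_congr rfl this, Finset.sum_add_distrib]
          have a1 : (if v s = v s then 1 else 0) ≤ ∑ t ∈ range n, (if v t = v s then 1 else 0) :=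
            Finset.single_le_sum (f := fun t => if v t = v s then 1 else 0)
              (fun _ _ => Nat.zero_le _) (mem_range.2 hs)
          have a2 : 1 ≤ ∑ t ∈ range n, (if v (t+1) = v s then 1 else 0) := by
            have hr : ∃ r < n, v (r+1) = v s := by
              rcases s with _ | s
              · exact ⟨n-1, by omega, by rw [Nat.sub_add_cancel hn, hv]⟩
              · exact ⟨s, by omega, rfl⟩
            obtain ⟨r, hr, hrs⟩ := hr
            have := Finset.single_le_sum (f := fun t => if v (t+1) = v s then 1 else 0)
              (fun _ _ => Nat.zero_le _) (mem_range.2 hr)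
            simpa [hrs] using this
          rw [if_pos rfl] at a1
          omega
        have h3 : edgeCount (ends c) (v s) + ∑ f ∈ (range n).image e, edgeCount (ends f) (v s)
            ≤ ∑ f ∈ CE, edgeCount (ends f) (v s) := by
          rw [← Finset.sum_insert (f := fun f => edgeCount (ends f) (v s)) hcn]
          apply Finset.sum_le_sum_of_subset
          intro f hf
          rcases mem_insert.1 hf with rfl | h
          · exact hc
          · exact hsub h
        have h4 := edgeCount_pos_of_mem huc
        rcases hdeg (v s) with h | h <;> omega
    exact key f (hconn _ (hmem 0 hn) _ hf)
  obtain ⟨x, y, hxy⟩ : ∃ x y, ends e₀ = s(x, y) := by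
    induction h : ends e₀ using Sym2.ind with
    | _ a b => exact ⟨a, b, rfl⟩
  by_cases hne : x = y
  · subst hne
    exact ⟨1, fun _ => e₀, fun _ => x, by omega, rfl, fun _ _ => hxy, fun s t _ _ _ => by omega,
      fun s t _ _ _ => by omega, fun _ _ => he₀⟩
  have hsum : ∀ u, edgeCount (ends e₀) u + ∑ f ∈ CE.erase e₀, edgeCount (ends f) u =
      ∑ f ∈ CE, edgeCount (ends f) u :=
    fun u => Finset.add_sum_erase CE (fun f => edgeCount (ends f) u) he₀
  have hc : ∀ u, edgeCount (ends e₀) u = (if x = u then 1 else 0) + (if y = u then 1 else 0) := by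
    intro u; rw [hxy, edgeCount_mk]
  obtain ⟨n, e, v, h0, hn, hE, hpos, hinj⟩ := path_exists ends _ (CE.erase e₀) x y le_rfl hne
    (by
      have := hsum x
      rw [hc, if_pos rfl, if_neg (Ne.symm hne)] at this
      rcases hdeg x with h | h <;> omega)
    (by
      have := hsum y
      rw [hc, if_pos rfl, if_neg hne] at this
      rcases hdeg y with h | h <;> omega)
    (by
      intro u hux huy
      have := hsum u
      rw [hc, if_neg (Ne.symm hux), if_neg (Ne.symm huy)] at this
      rcases hdeg u with h | h
      · left; omega
      · right; omega)
  refine ⟨n+1, fun t => if t = n then e₀ else e t, fun t => if t = n+1 then x else v t, by omega,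
    by simp [h0], ?_, ?_, ?_, ?_⟩
  · intro t ht
    by_cases htn : t = n
    · subst htn
      simp [hxy, hn, Sym2.eq_swap]
    · have := (hE t (by omega)).2
      simp only [if_neg htn, if_neg (show t ≠ n+1 by omega), if_neg (show t + 1 ≠ n+1 by omega)]
      exact this
  · intro s t hs ht h
    simp only [if_neg (show s ≠ n+1 by omega), if_neg (show t ≠ n+1 by omega)] at h
    exact hinj s t (by omega) (by omega) h
  · intro s t hs ht h
    dsimp only at h
    split_ifs at h with h1 h2 h2
    · omega
    · have := (hE t (by omega)).1
      rw [← h] at this; simp at this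
    · have := (hE s (by omega)).1
      rw [h] at this; simp at this
    · have e1 := (hE s (by omega)).2
      have e2 := (hE t (by omega)).2
      rw [h, e2] at e1
      rcases Sym2.eq_iff.1 e1 with ⟨a, _⟩ | ⟨a, b⟩
      · exact (hinj _ _ (by omega) (by omega) a).symm
      · have := hinj _ _ (by omega) (by omega) a
        have := hinj _ _ (by omega) (by omega) b
        omega
  · intro t ht
    by_cases htn : t = n
    · simp [htn, he₀]
    · simp only [if_neg htn]; exact Finset.mem_of_mem_erase (hE t (by omega)).1

/-- Boundary of a mod 2 chain. -/
def bdz (ends : E → Sym2 V) (r : E → ZMod 2) (u : V) : ZMod 2 :=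
  ∑ e, (edgeCount (ends e) u : ZMod 2) * r e

lemma chain_exists (ends : E → Sym2 V) (K : Set E) {a b : V}
    (h : Relation.ReflTransGen (fun u w => ∃ e ∈ K, u ∈ ends e ∧ w ∈ ends e) a b) :
    ∃ r : E → ZMod 2, (∀ e, e ∉ K → r e = 0) ∧
      ∀ u, bdz ends r u = (if a = u then 1 else 0) + (if b = u then 1 else 0) := by
  induction h with
  | refl =>
    refine ⟨fun _ => 0, fun _ _ => rfl, fun u => ?_⟩
    simp only [bdz, mul_zero, Finset.sum_const_zero]
    split_ifs <;> decide
  | @tail b c _ hbc ih =>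
    obtain ⟨r, hr, hb⟩ := ih
    obtain ⟨e, he, hbe, hce⟩ := hbc
    by_cases hbc : b = c
    · subst hbc; exact ⟨r, hr, hb⟩
    have hends : ends e = s(b, c) := (Sym2.mem_and_mem_iff hbc).1 ⟨hbe, hce⟩
    refine ⟨fun f => r f + if f = e then 1 else 0, ?_, ?_⟩
    · intro f hf
      dsimp only
      rw [hr f hf, if_neg (by rintro rfl; exact hf he), add_zero]
    · intro u
      have : bdz ends (fun f => r f + if f = e then 1 else 0) u =
          bdz ends r u + (edgeCount (ends e) u : ZMod 2) := by
        simp [bdz, mul_add, Finset.sum_add_distrib]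
      rw [this, hb, hends, edgeCount_mk]
      push_cast
      have h2 : ∀ p q r : ZMod 2, p + q + (q + r) = p + r := by decide
      exact h2 _ _ _

lemma symp_nsmul (i a : ZMod 2 × ZMod 2) (k : ℕ) : symp i (k • a) = (k : ZMod 2) * symp i a := by
  simp [symp]; ring

lemma handshake (ends : E → Sym2 V) (s : E → ZMod 2) (U : Finset V)
    (hU : ∀ f, s f ≠ 0 → ∀ u w, u ∈ ends f → w ∈ ends f → u ∈ U → w ∈ U) :
    ∑ u ∈ U, bdz ends s u = 0 := by
  unfold bdz
  rw [Finset.sum_comm]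
  apply Finset.sum_eq_zero
  intro f _
  by_cases hs : s f = 0
  · simp [hs]
  rw [← Finset.sum_mul]
  obtain ⟨a, b, hab⟩ : ∃ a b, ends f = s(a, b) := by
    induction h : ends f using Sym2.ind with
    | _ a b => exact ⟨a, b, rfl⟩
  have h1 := hU f hs
  have hiff : a ∈ U ↔ b ∈ U :=
    ⟨h1 a b (by simp [hab]) (by simp [hab]), h1 b a (by simp [hab]) (by simp [hab])⟩
  have : ∑ u ∈ U, ((edgeCount (ends f) u : ℕ) : ZMod 2) = 0 := by
    simp only [hab, edgeCount_mk, Nat.cast_add, Nat.cast_ite, Nat.cast_one, Nat.cast_zero,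
      Finset.sum_add_distrib, Finset.sum_ite_eq, hiff]
    split_ifs <;> decide
  rw [this, zero_mul]

/-- Boundary of the part of `g` off `C`. -/
def bdo (ends : E → Sym2 V) (CE : Finset E) (g : E → ZMod 2 × ZMod 2) (u : V) : ZMod 2 × ZMod 2 :=
  ∑ f ∈ univ.filter (fun f => f ∉ CE), edgeCount (ends f) u • g f

lemma symp_bdo (ends : E → Sym2 V) (CE : Finset E) (g : E → ZMod 2 × ZMod 2) (i) (u : V) :
    symp i (bdo ends CE g u) = bdz ends (fun f => if f ∈ CE then 0 else symp i (g f)) u := by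
  rw [bdo, symp_sum, bdz, Finset.sum_filter]
  apply Finset.sum_congr rfl
  intro f _
  by_cases h : f ∈ CE
  · simp [h]
  · simp only [h, not_false_eq_true, if_true, if_false]
    exact symp_nsmul _ _ _

lemma bdo_eq (ends : E → Sym2 V) (CE : Finset E) (g : E → ZMod 2 × ZMod 2) (hg : IsFlow ends g)
    (u : V) : bdo ends CE g u = ∑ f ∈ CE, edgeCount (ends f) u • g f := by
  have h := hg u
  rw [← Finset.sum_filter_add_sum_filter_not univ (fun f => f ∉ CE)] at h
  have h2 : univ.filter (fun f => ¬ f ∉ CE) = CE := by ext f; simp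
  rw [h2] at h
  have h3 : ∀ a b : ZMod 2 × ZMod 2, a + b = 0 → a = b := by decide
  exact h3 _ _ h

/-- The switched flow. -/
def swf (g : E → ZMod 2 × ZMod 2) (i : ZMod 2 × ZMod 2) (r₁ r₂ : E → ZMod 2) :
    E → ZMod 2 × ZMod 2 := fun f => g f + (r₁ f + r₂ f) • i

lemma sum_smul_bdz (ends : E → Sym2 V) (r : E → ZMod 2) (i : ZMod 2 × ZMod 2) (u : V) :
    ∑ f, edgeCount (ends f) u • (r f • i) = bdz ends r u • i := by
  rw [bdz, Finset.sum_smul]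
  apply Finset.sum_congr rfl
  intro f _
  rw [mul_smul, Nat.cast_smul_eq_nsmul]

lemma swf_flow (ends : E → Sym2 V) (g : E → ZMod 2 × ZMod 2) (hg : IsFlow ends g) (i)
    (r₁ r₂ : E → ZMod 2) (h : ∀ u, bdz ends r₁ u = bdz ends r₂ u) :
    IsFlow ends (swf g i r₁ r₂) := by
  intro u
  simp only [swf, add_smul, smul_add, Finset.sum_add_distrib, sum_smul_bdz]
  rw [hg u, h u, zz_self, zero_add]

lemma swf_bdo (ends : E → Sym2 V) (CE : Finset E) (g : E → ZMod 2 × ZMod 2) (i)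
    (r₁ r₂ : E → ZMod 2) (h₁ : ∀ f ∈ CE, r₁ f = 0) (h₂ : ∀ f, f ∉ CE → r₂ f = 0) (u : V) :
    bdo ends CE (swf g i r₁ r₂) u = bdo ends CE g u + bdz ends r₁ u • i := by
  rw [← sum_smul_bdz]
  simp only [bdo, swf, Finset.sum_filter]
  rw [← Finset.sum_add_distrib]
  apply Finset.sum_congr rfl
  intro f _
  by_cases hf : f ∈ CE
  · simp [hf, h₁ f hf]
  · simp [hf, h₂ f hf]

lemma contra (ends : E → Sym2 V) (CE : Finset E) (hC : IsCircuit ends CE)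
    (ω : E → ℕ) (hω : ∀ e, 0 < ω e)
    (g : E → ZMod 2 × ZMod 2) (hg : IsFlow ends g)
    (hbal : ∀ g' : E → ZMod 2 × ZMod 2, IsFlow ends g' →
      (∀ e, e ∉ CE → (g' e ≠ 0 ↔ g e ≠ 0)) →
      ∀ a : ZMod 2 × ZMod 2,
        4 * ∑ e ∈ CE.filter (fun e => g' e = a), ω e = ∑ e ∈ CE, ω e) : False := by
  classical
  obtain ⟨n, e, v, hn, hv, hE, hvi, hei, hCE⟩ := circuit_enum ends CE hC
  have hmem : ∀ t < n, e t ∈ CE := by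
    intro t ht; rw [hCE]; exact mem_image.2 ⟨t, mem_range.2 ht, rfl⟩
  have hvi1 : ∀ s t, s < n → t < n → v (s+1) = v (t+1) → s = t := by
    intro s t hs ht h
    by_cases h1 : s + 1 = n <;> by_cases h2 : t + 1 = n
    · omega
    · rw [h1, hv] at h; have := hvi 0 (t+1) hn (by omega) h; omega
    · rw [h2, hv] at h; have := hvi (s+1) 0 (by omega) hn h; omega
    · have := hvi (s+1) (t+1) (by omega) (by omega) h; omega
  have hsumCE : ∀ (g' : E → ZMod 2 × ZMod 2) (u : V), ∑ f ∈ CE, edgeCount (ends f) u • g' f =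
      ∑ t ∈ range n, (if v t = u then g' (e t) else 0) +
      ∑ t ∈ range n, (if v (t+1) = u then g' (e t) else 0) := by
    intro g' u
    rw [hCE, Finset.sum_image (fun a ha b hb h => hei a b (mem_range.1 ha) (mem_range.1 hb) h),
      ← Finset.sum_add_distrib]
    apply Finset.sum_congr rfl
    intro t ht
    rw [hE t (mem_range.1 ht), edgeCount_mk, add_smul]
    congr 1 <;> split_ifs <;> simp
  let S : Set (ℕ → ZMod 2 × ZMod 2) := {d | ∃ g' : E → ZMod 2 × ZMod 2, IsFlow ends g' ∧
    (∀ e, e ∉ CE → (g' e ≠ 0 ↔ g e ≠ 0)) ∧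
    d = fun t => if t < n then bdo ends CE g' (v (t+1)) else 0}
  have hne : S.Nonempty := ⟨_, g, hg, fun _ _ => Iff.rfl, rfl⟩
  have hK : KClosed n S := by
    rintro d ⟨g', hg', hs', hd⟩ i hi B hB hodd
    have hdt : ∀ t < n, d t = bdo ends CE g' (v (t+1)) := by
      intro t ht; rw [hd]; simp [ht]
    let K : Set E := {f | f ∉ CE ∧ symp i (g' f) = 1}
    let R : V → V → Prop := fun u w => ∃ e ∈ K, u ∈ ends e ∧ w ∈ ends e
    -- the pair
    have hpair : ∃ x y, x ∈ B ∧ y ∉ B ∧ y < n ∧ symp i (d x) = 1 ∧ symp i (d y) = 1 ∧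
        Relation.ReflTransGen R (v (x+1)) (v (y+1)) := by
      by_contra hno
      let U : Finset V := univ.filter fun u => ∃ t ∈ B, symp i (d t) = 1 ∧
        Relation.ReflTransGen R (v (t+1)) u
      have hh := handshake ends (fun f => if f ∈ CE then 0 else symp i (g' f)) U (by
        intro f hf u w hu hw huU
        have hfK : f ∈ K := by
          split_ifs at hf with h
          · exact absurd rfl hf
          · exact ⟨h, (z2_cases _).resolve_left hf⟩
        obtain ⟨t, htB, ht1, htu⟩ := (mem_filter.1 huU).2
        exact mem_filter.2 ⟨mem_univ _, t, htB, ht1, htu.tail ⟨f, hfK, hu, hw⟩⟩)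
      apply hodd
      rw [← hh]
      simp only [← symp_bdo]
      have hinj : Set.InjOn (fun t => v (t+1)) (range n : Set ℕ) := by
        intro s hs t ht h
        exact hvi1 s t (by simpa using hs) (by simpa using ht) h
      have e1 : ∑ t ∈ B, symp i (d t) = ∑ u ∈ B.image (fun t => v (t+1)), symp i (bdo ends CE g' u) := by
        rw [Finset.sum_image (fun s hs t ht h => hinj (hB hs) (hB ht) h)]
        exact Finset.sum_congr rfl fun t ht => by rw [hdt t (mem_range.1 (hB ht))]
      rw [e1]
      have hz : ∀ u, (∀ t < n, u ≠ v (t+1)) → symp i (bdo ends CE g' u) = 0 := by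
        intro u hu
        rw [bdo_eq ends CE g' hg', hsumCE, Finset.sum_eq_zero, Finset.sum_eq_zero, add_zero, symp_zero]
        · intro t ht; rw [if_neg (fun h => hu t (mem_range.1 ht) h.symm)]
        · intro t ht
          rw [if_neg]
          rintro rfl
          rcases t with _ | t
          · exact hu (n-1) (by omega) (by rw [Nat.sub_add_cancel hn, hv])
          · exact hu t (by have := mem_range.1 ht; omega) rfl
      -- compare both sums inside `U ∪ image`
      have f1 : ∑ u ∈ B.image (fun t => v (t+1)), symp i (bdo ends CE g' u) =
          ∑ u ∈ B.image (fun t => v (t+1)) ∪ U, symp i (bdo ends CE g' u) := by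
        apply Finset.sum_subset Finset.subset_union_left
        intro u hu hnu
        have huU : u ∈ U := (mem_union.1 hu).resolve_left hnu
        obtain ⟨t, htB, ht1, htu⟩ := (mem_filter.1 huU).2
        by_cases hex : ∃ s < n, u = v (s+1)
        · obtain ⟨s, hs, rfl⟩ := hex
          rcases z2_cases (symp i (bdo ends CE g' (v (s+1)))) with h | h
          · exact h
          · exfalso
            apply hno
            refine ⟨t, s, htB, ?_, hs, ht1, by rw [hdt s hs, h], htu⟩
            intro hsB; exact hnu (mem_image.2 ⟨s, hsB, rfl⟩)
        · exact hz u fun s hs h => hex ⟨s, hs, h⟩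
      have f2 : ∑ u ∈ U, symp i (bdo ends CE g' u) =
          ∑ u ∈ B.image (fun t => v (t+1)) ∪ U, symp i (bdo ends CE g' u) := by
        apply Finset.sum_subset Finset.subset_union_right
        intro u hu hnu
        obtain ⟨s, hsB, rfl⟩ := mem_image.1 ((mem_union.1 hu).resolve_right hnu)
        rcases z2_cases (symp i (bdo ends CE g' (v (s+1)))) with h | h
        · exact h
        · exfalso
          apply hnu
          exact mem_filter.2 ⟨mem_univ _, s, hsB, by rw [hdt s (mem_range.1 (hB hsB)), h],
            Relation.ReflTransGen.refl⟩
      rw [f1, f2]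
    obtain ⟨x, y, hx, hy, hyn, hx1, hy1, hreach⟩ := hpair
    refine ⟨x, y, hx, hy, hyn, hx1, hy1, ?_⟩
    have hxn : x < n := mem_range.1 (hB hx)
    have hxy : x ≠ y := by rintro rfl; exact hy hx
    obtain ⟨r₁, hr₁, hb₁⟩ := chain_exists ends K hreach
    have hR0 : ∀ t ≤ n, Relation.ReflTransGen
        (fun u w => ∃ e ∈ (CE : Set E), u ∈ ends e ∧ w ∈ ends e) (v 0) (v t) := by
      intro t
      induction t with
      | zero => intro _; exact Relation.ReflTransGen.refl
      | succ t ih =>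
        intro ht
        refine (ih (by omega)).tail ⟨e t, hmem t (by omega), ?_, ?_⟩ <;>
          simp [hE t (by omega)]
    have hR1 : ∀ t ≤ n, Relation.ReflTransGen
        (fun u w => ∃ e ∈ (CE : Set E), u ∈ ends e ∧ w ∈ ends e) (v t) (v 0) := by
      intro t
      induction t with
      | zero => intro _; exact Relation.ReflTransGen.refl
      | succ t ih =>
        intro ht
        refine (ih (by omega)).head ⟨e t, hmem t (by omega), ?_, ?_⟩ <;>
          simp [hE t (by omega)]
    obtain ⟨r₂, hr₂, hb₂⟩ := chain_exists ends (CE : Set E)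
      ((hR1 (x+1) (by omega)).trans (hR0 (y+1) (by omega)))
    have hr₁C : ∀ f ∈ CE, r₁ f = 0 := fun f hf => hr₁ f fun h => h.1 hf
    have hr₂C : ∀ f, f ∉ CE → r₂ f = 0 := fun f hf => hr₂ f (by simpa using hf)
    refine ⟨swf g' i r₁ r₂, swf_flow ends g' hg' i r₁ r₂ (fun u => by rw [hb₁, hb₂]), ?_, ?_⟩
    · intro f hf
      rw [← hs' f hf, swf, hr₂C f hf, add_zero]
      by_cases hfK : f ∈ K
      · have h1 := hfK.2
        have : ∀ (r : ZMod 2) (i a : ZMod 2 × ZMod 2), symp i a = 1 →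
            (a + r • i ≠ 0 ↔ a ≠ 0) := by decide
        exact this _ _ _ h1
      · rw [hr₁ f hfK, zero_smul, add_zero]
    · funext t
      simp only [sw]
      by_cases ht : t < n
      · rw [if_pos ht, swf_bdo ends CE g' i r₁ r₂ hr₁C hr₂C, ← hdt t ht, hb₁]
        congr 1
        by_cases h1 : t = x
        · subst h1
          rw [if_pos rfl, if_neg (fun h => hxy (hvi1 _ _ hyn ht h).symm), if_pos (Or.inl rfl)]
          simp
        · by_cases h2 : t = y
          · subst h2
            rw [if_pos rfl, if_neg (fun h => hxy (hvi1 _ _ hxn ht h)), if_pos (Or.inr rfl)]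
            simp
          · rw [if_neg (fun h => h1 (hvi1 _ _ hxn ht h).symm),
              if_neg (fun h => h2 (hvi1 _ _ hyn ht h).symm), if_neg (by tauto)]
            simp
      · rw [if_neg ht, if_neg (by omega), hd]
        simp [ht]
  have hM := descent n S hK (range n) (by
    rintro d ⟨g', _, _, rfl⟩ t ht
    rw [mem_range] at ht
    simp [ht]) hne (∑ f ∈ CE.filter (fun f => g f = 0), ω f) (fun t => ω (e t)) (by
    rintro d ⟨g', hg', hs', hd⟩ c
    have hval : ∀ t < n, g' (e t) = g' (e 0) + psum d t := by
      intro t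
      induction t with
      | zero => intro _; simp [psum]
      | succ t ih =>
        intro ht
        rw [psum_succ, ← add_assoc, ← ih (by omega), hd]
        simp only [if_pos (show t < n by omega)]
        rw [bdo_eq ends CE g' hg', hsumCE,
          Finset.sum_eq_single_of_mem (t+1) (mem_range.2 ht) (by
            intro s hs hst
            rw [if_neg fun h => hst (hvi _ _ (mem_range.1 hs) ht h)]),
          Finset.sum_eq_single_of_mem t (mem_range.2 (by omega)) (by
            intro s hs hst
            rw [if_neg fun h => hst (hvi1 _ _ (mem_range.1 hs) (by omega) h)]),
          if_pos rfl, if_pos rfl]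
        have : ∀ a b : ZMod 2 × ZMod 2, b = a + (b + a) := by decide
        exact this _ _
    have h1 := hbal g' hg' hs' (g' (e 0) + c)
    have h2 := hbal g hg (fun _ _ => Iff.rfl) 0
    have h3 : ∑ t ∈ range n, (if psum d t = c then ω (e t) else 0) =
        ∑ f ∈ CE.filter (fun f => g' f = g' (e 0) + c), ω f := by
      rw [Finset.sum_filter, hCE,
        Finset.sum_image (fun a ha b hb h => hei a b (mem_range.1 ha) (mem_range.1 hb) h)]
      apply Finset.sum_congr rfl
      intro t ht
      rw [hval t (mem_range.1 ht)]
      simp only [add_right_inj]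
    rw [h3]
    omega)
  have h2 := hbal g hg (fun _ _ => Iff.rfl) 0
  rw [hM, mul_zero] at h2
  have h3 := Finset.sum_eq_zero_iff.1 h2.symm (e 0) (hmem 0 hn)
  have := hω (e 0)
  omega

end graph

/-- Lemma 3.4, second assertion: if every flow with the same
support off `C` has all four classes of weight `ω(C)/4` on `C`, and `Q` is a path
of `C` between odd-degree vertices `x, y` of one component of `P_{a,a+b}`, then
`ω(E_{g=c}(Q)) = ω(E_{g=c+b}(Q))` for every `c`. -/
theorem path_class_weights_eq {V E : Type} [Fintype V] [Fintype E] [DecidableEq V] [DecidableEq E]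
    (ends : E → Sym2 V) (CE : Finset E) (hC : IsCircuit ends CE)
    (ω : E → ℕ) (hω : ∀ e, 0 < ω e)
    (g : E → ZMod 2 × ZMod 2) (hg : IsFlow ends g)
    -- every flow in `ℛ_C(g)` has all four classes of weight `ω(C)/4` on `C`
    (hbal : ∀ g' : E → ZMod 2 × ZMod 2, IsFlow ends g' →
      (∀ e, e ∉ CE → (g' e ≠ 0 ↔ g e ≠ 0)) →
      ∀ a : ZMod 2 × ZMod 2,
        4 * ∑ e ∈ CE.filter (fun e => g' e = a), ω e = ∑ e ∈ CE, ω e)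
    (a b : ZMod 2 × ZMod 2) (hb : b ≠ 0)
    (x y : V) (hxy : x ≠ y)
    -- `Q` is a path of `C` from `x` to `y`
    (Q : Finset E) (hQsub : Q ⊆ CE)
    (hQpath : ∀ v : V, Odd (∑ e ∈ Q, edgeCount (ends e) v) ↔ (v = x ∨ v = y))
    -- `x` and `y` are odd-degree vertices of the same component of `P_{a,a+b}`
    (P : Finset E) (hP : P = Finset.univ.filter fun e => e ∉ CE ∧ (g e = a ∨ g e = a + b))
    (hoddx : Odd (∑ e ∈ P, edgeCount (ends e) x))
    (hoddy : Odd (∑ e ∈ P, edgeCount (ends e) y))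
    (hconn : Relation.ReflTransGen (fun u w => ∃ e ∈ P, u ∈ ends e ∧ w ∈ ends e) x y) :
    ∀ c : ZMod 2 × ZMod 2,
      ∑ e ∈ Q.filter (fun e => g e = c), ω e =
      ∑ e ∈ Q.filter (fun e => g e = c + b), ω e := by
  exact (contra ends CE hC ω hω g hg hbal).elim
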